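/- Let (T, μ, η) be an idempotent Hopf monad on a category 𝕏 with finite biproducts. Then the inverse of the fusion operator h⁻¹_{A,B} : T(A) ⊕ T(B) → T(A ⊕ T(B)) is given by h⁻¹_{A,B} = T(ι₁) ∘ π₁ + T(ι₂) ∘ η_{T(B)} ∘ π₂. -/

import Mathlib

/-!
Hopf monads on a category with finite biproducts (Bruguières–Lack–Virelizier style),
following "Hopf Monads on Biproducts".

Setting: `C` is a category with a zero object and binary biproducts (hence zero
morphisms), so that each hom-set carries the commutative monoid structure induced by
the biproducts.  `badd f g` is the induced addition of parallel maps.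
-/

namespace HopfBiproducts

open CategoryTheory CategoryTheory.Limits ZeroObject

universe v u

variable {C : Type u} [Category.{v} C] [HasZeroObject C] [HasZeroMorphisms C]
  [HasBinaryBiproducts C]

/-- The addition of parallel maps induced by binary biproducts:
`f + g = ⟨f, g⟩ ≫ [1, 1]`. -/
noncomputable def badd {X Y : C} (f g : X ⟶ Y) : X ⟶ Y :=
  biprod.lift f g ≫ biprod.desc (𝟙 Y) (𝟙 Y)

/-- The fusion operator `h_{A,B} = ι₁ ∘ T(π₁) + ι₂ ∘ μ_B ∘ T(π₂)` of a monad on a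
category with finite biproducts. -/
noncomputable def fusion (T : Monad C) (A B : C) :
    T.obj (A ⊞ T.obj B) ⟶ T.obj A ⊞ T.obj B :=
  badd (T.map biprod.fst ≫ biprod.inl) (T.map biprod.snd ≫ T.μ.app B ≫ biprod.inr)


set_option linter.unusedSectionVars false

theorem badd_comp {X Y Z : C} (f g : X ⟶ Y) (q : Y ⟶ Z) :
    badd f g ≫ q = badd (f ≫ q) (g ≫ q) := by
  have h₁ : biprod.lift (f ≫ q) (g ≫ q) = biprod.lift f g ≫ biprod.map q q := by
    ext <;> simp
  have h₂ : biprod.map q q ≫ biprod.desc (𝟙 Z) (𝟙 Z) = biprod.desc (𝟙 Y) (𝟙 Y) ≫ q := by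
    ext <;> simp
  simp only [badd, h₁, Category.assoc, h₂]

@[simp]
theorem badd_zero {X Y : C} (f : X ⟶ Y) : badd f 0 = f := by
  have h : biprod.lift f (0 : X ⟶ Y) = f ≫ biprod.inl := by ext <;> simp
  simp [badd, h]

@[simp]
theorem zero_badd {X Y : C} (f : X ⟶ Y) : badd 0 f = f := by
  have h : biprod.lift (0 : X ⟶ Y) f = f ≫ biprod.inr := by ext <;> simp
  simp [badd, h]

@[simp]
theorem fusion_fst (T : Monad C) (A B : C) :
    fusion T A B ≫ biprod.fst = T.map biprod.fst := by
  simp [fusion, badd_comp]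

@[simp]
theorem fusion_snd (T : Monad C) (A B : C) :
    fusion T A B ≫ biprod.snd = T.map biprod.snd ≫ T.μ.app B := by
  simp [fusion, badd_comp]

/-- Over an idempotent monad, every map between free algebras is the extension of its
restriction along the unit. -/
theorem map_unit_comp_mu (T : Monad C) (hidem : ∀ A : C, IsIso (T.μ.app A)) {A B : C}
    (f : T.obj A ⟶ T.obj B) : T.map (T.η.app A ≫ f) ≫ T.μ.app B = f := by
  have := hidem A
  have h : T.μ.app A ≫ f = T.map f ≫ T.μ.app B := by
    have hA : T.μ.app A ≫ T.η.app (T.obj A) = 𝟙 _ := by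
      rw [← IsIso.inv_eq_of_inv_hom_id (T.left_unit A)]
      simp
    have hf : f ≫ T.η.app (T.obj B) = T.η.app (T.obj A) ≫ T.map f := T.η.naturality f
    calc T.μ.app A ≫ f = T.μ.app A ≫ f ≫ T.η.app (T.obj B) ≫ T.μ.app B := by
          rw [T.left_unit]; simp
      _ = (T.μ.app A ≫ T.η.app (T.obj A)) ≫ T.map f ≫ T.μ.app B := by
          rw [reassoc_of% hf, Category.assoc]
      _ = T.map f ≫ T.μ.app B := by rw [hA, Category.id_comp]
  rw [T.map_comp, Category.assoc, ← h, ← Category.assoc, T.right_unit]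
  exact Category.id_comp f

theorem map_zero_comp_mu (T : Monad C) (hidem : ∀ A : C, IsIso (T.μ.app A)) (A B : C) :
    T.map (0 : A ⟶ T.obj B) ≫ T.μ.app B = 0 := by
  simpa using map_unit_comp_mu T hidem (0 : T.obj A ⟶ T.obj B)

theorem unit_comp_map_zero (T : Monad C) (A B : C) :
    T.η.app A ≫ T.map (0 : A ⟶ B) = 0 := by
  simpa using (T.η.naturality (0 : A ⟶ B)).symm

/-- for an idempotent Hopf monad on a category with finite biproducts,
the inverse of the fusion operator is `h⁻¹_{A,B} = T(ι₁) ∘ π₁ + T(ι₂) ∘ η_{T(B)} ∘ π₂`. -/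
theorem inv_fusion_of_idempotent (T : Monad C) (hidem : ∀ A : C, IsIso (T.μ.app A))
    [∀ A B : C, IsIso (fusion T A B)] (A B : C) :
    inv (fusion T A B) =
      badd (biprod.fst ≫ T.map (biprod.inl : A ⟶ A ⊞ T.obj B))
        (biprod.snd ≫ T.η.app (T.obj B) ≫ T.map biprod.inr) := by
  apply IsIso.inv_eq_of_inv_hom_id
  apply biprod.hom_ext
  · simp only [Category.assoc, fusion_fst, badd_comp, Category.id_comp, ← T.map_comp,
      biprod.inl_fst, biprod.inr_fst, unit_comp_map_zero, T.map_id, comp_zero, badd_zero]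
    exact Category.comp_id _
  · have hl : T.map (biprod.inl : A ⟶ A ⊞ T.obj B) ≫ T.map biprod.snd ≫ T.μ.app B = 0 := by
      rw [← Category.assoc, ← T.map_comp, biprod.inl_snd, map_zero_comp_mu T hidem]
    have hr : T.map (biprod.inr : T.obj B ⟶ A ⊞ T.obj B) ≫ T.map biprod.snd ≫ T.μ.app B =
        T.μ.app B := by
      rw [← Category.assoc, ← T.map_comp, biprod.inr_snd, T.map_id]
      exact Category.id_comp _
    simp only [Category.assoc, fusion_snd, badd_comp, Category.id_comp, hl, hr, comp_zero,
      zero_badd, T.left_unit]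
    exact Category.comp_id _

end HopfBiproducts
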